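/- Let X be a finite poset and k a field. If the incidence algebra kX is piecewise hereditary, then gldim kX ≤ 3, and projd Q + injd Q ≤ 4 for every indecomposable kX-module Q. -/

import Mathlib

/-!
Statement 3: if the incidence algebra `kX` of a finite poset `X` is piecewise
hereditary, then `gldim kX ≤ 3` and `projd Q + injd Q ≤ 4` for every
indecomposable `kX`-module `Q` (finite dimensional right modules being
realized as finitely generated `(kX)ᵐᵒᵖ`-modules).
-/

open CategoryTheory CategoryTheory.Limits

set_option synthInstance.maxHeartbeats 800000
set_option maxHeartbeats 1600000

universe w w' v' u' v₁ u₁ u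

namespace PiecewiseHereditaryPaper

section AbstractDefs

variable (𝒜 : Type u₁) [Category.{v₁} 𝒜] [Abelian 𝒜] [HasDerivedCategory.{w} 𝒜]

/-- `Ext^d(X,Y) ≠ 0`, where `Ext^d` is computed as `Hom_{D(𝒜)}(X[0], Y[0][d])`. -/
def extNonzero (X Y : 𝒜) (d : ℤ) : Prop :=
  ∃ g : (DerivedCategory.singleFunctor 𝒜 0).obj X ⟶
      (((DerivedCategory.singleFunctor 𝒜 0).obj Y)⟦d⟧), g ≠ 0

/-- The projective dimension `projd Q = sup {d : Ext^d(Q,Q') ≠ 0 for some Q'}`. -/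
noncomputable def projDim (Q : 𝒜) : ℕ∞ :=
  ⨆ (d : ℕ) (_ : ∃ Q' : 𝒜, extNonzero 𝒜 Q Q' d), (d : ℕ∞)

/-- The injective dimension `injd Q = sup {d : Ext^d(Q',Q) ≠ 0 for some Q'}`. -/
noncomputable def injDim (Q : 𝒜) : ℕ∞ :=
  ⨆ (d : ℕ) (_ : ∃ Q' : 𝒜, extNonzero 𝒜 Q' Q d), (d : ℕ∞)

/-- The global dimension `gldim = sup_Q projd Q`. -/
noncomputable def gldim : ℕ∞ := ⨆ Q : 𝒜, projDim 𝒜 Q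

/-- An abelian category is hereditary if `Ext^d` vanishes for all `d ≥ 2`. -/
def Hereditary : Prop := ∀ (X Y : 𝒜) (d : ℕ), 2 ≤ d → ¬ extNonzero 𝒜 X Y (d : ℤ)

/-- A triangulated equivalence `D(𝒜) ≃ D(ℋ)`. -/
structure TriangulatedEquivalence (ℋ : Type u') [Category.{v'} ℋ] [Abelian ℋ]
    [HasDerivedCategory.{w'} ℋ] where
  functor : DerivedCategory 𝒜 ⥤ DerivedCategory ℋ
  isEquivalence : functor.IsEquivalence
  commShift : functor.CommShift ℤ
  isTriangulated : letI := commShift; functor.IsTriangulated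

/-- `𝒜` is piecewise hereditary if there are a hereditary abelian category `ℋ`
and a triangulated equivalence `D(𝒜) ≃ D(ℋ)`. -/
def IsPiecewiseHereditary : Prop :=
  ∃ (ℋ : Type u') (_ : Category.{v'} ℋ) (_ : Abelian ℋ) (_ : HasDerivedCategory.{w'} ℋ),
    Hereditary ℋ ∧ Nonempty (TriangulatedEquivalence 𝒜 ℋ)

end AbstractDefs

variable (k : Type u) [Field k]
variable (X : Type u) [PartialOrder X] [DecidableEq X]
  [LocallyFiniteOrder X]

/-- The category `mod kX` of finite dimensional right modules over the
incidence algebra `kX` of the finite poset `X`. -/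
abbrev ModKX := FGModuleCat (IncidenceAlgebra k X)ᵐᵒᵖ

variable [Abelian (ModKX k X)]

noncomputable instance : HasBinaryBiproducts (ModKX k X) :=
  HasBinaryBiproducts.of_hasBinaryProducts


section TriAux

open Pretriangulated

variable {D : Type u₁} [Category.{v₁} D] [Preadditive D] [HasZeroObject D] [HasShift D ℤ]
  [∀ n : ℤ, (shiftFunctor D n).Additive] [Pretriangulated D]

lemma tri_lift {T A B Z : D} (f : A ⟶ B) (q : B ⟶ Z) (δ : Z ⟶ A⟦(1 : ℤ)⟧)
    (h : Triangle.mk f q δ ∈ distTriang D) (x : T ⟶ Z⟦(1 : ℤ)⟧) (hx : x ≫ δ⟦(1 : ℤ)⟧' = 0) :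
    ∃ g : T ⟶ B⟦(1 : ℤ)⟧, x = g ≫ q⟦(1 : ℤ)⟧' := by
  obtain ⟨g, hg'⟩ : ∃ g : T ⟶ B⟦(1 : ℤ)⟧, x = g ≫ (-(q⟦(1 : ℤ)⟧')) := Triangle.coyoneda_exact₃ _
    (rot_of_distTriang _ (rot_of_distTriang _ (rot_of_distTriang _ h))) (X := T) (x)
      (show x ≫ (-(δ⟦(1 : ℤ)⟧')) = 0 by rw [Preadditive.comp_neg, hx, neg_zero])
  exact ⟨-g, by rw [hg', Preadditive.comp_neg, Preadditive.neg_comp]⟩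

lemma tri_extend {T A B Z : D} (f : A ⟶ B) (q : B ⟶ Z) (δ : Z ⟶ A⟦(1 : ℤ)⟧)
    (h : Triangle.mk f q δ ∈ distTriang D) (x : A ⟶ T) (hx : δ ≫ x⟦(1 : ℤ)⟧' = 0) :
    ∃ g : B ⟶ T, x = f ≫ g := by
  obtain ⟨g', hg''⟩ : ∃ g' : B⟦(1 : ℤ)⟧ ⟶ T⟦(1 : ℤ)⟧, x⟦(1 : ℤ)⟧' = (-(f⟦(1 : ℤ)⟧')) ≫ g' :=
    Triangle.yoneda_exact₃ _ (rot_of_distTriang _ h) (x⟦(1 : ℤ)⟧') hx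
  obtain ⟨g, hg⟩ := (shiftFunctor D (1 : ℤ)).map_surjective g'
  refine ⟨-g, ?_⟩
  apply (shiftFunctor D (1 : ℤ)).map_injective
  rw [hg'', ← hg, Functor.map_comp, Functor.map_neg, Preadditive.comp_neg, Preadditive.neg_comp]

lemma tri_section {A B K Z H Y : D} (f : A ⟶ B) (q : B ⟶ K) (δ₂ : K ⟶ A⟦(1 : ℤ)⟧)
    (h₂ : Triangle.mk f q δ₂ ∈ distTriang D)
    (ι : K ⟶ Z) (π : Z ⟶ H) (δ₁ : H ⟶ K⟦(1 : ℤ)⟧) (h₁ : Triangle.mk ι π δ₁ ∈ distTriang D)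
    (hz : ∀ x : H ⟶ A⟦(1 : ℤ)⟧⟦(1 : ℤ)⟧, x = 0) (ζ : Z ⟶ Y) (hζ : q ≫ ι ≫ ζ = 0) :
    ∃ i : H ⟶ Y, ∀ (W : D) (_ : ∀ r : B⟦(1 : ℤ)⟧ ⟶ W, r = 0) (ξ : Y ⟶ W) (t : H ⟶ W),
      ζ ≫ ξ = π ≫ t → i ≫ ξ = t := by
  obtain ⟨g, hg⟩ := tri_lift f q δ₂ h₂ δ₁ (hz _)
  obtain ⟨E, u, v, hE⟩ := distinguished_cocone_triangle₂ g
  obtain ⟨b, hb1, hb2⟩ : ∃ b : E ⟶ Z, u ≫ b = q ≫ ι ∧ v ≫ 𝟙 _ = b ≫ π :=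
    complete_distinguished_triangle_morphism₂ _ _ hE h₁
    q (𝟙 _) (show g ≫ q⟦(1 : ℤ)⟧' = 𝟙 _ ≫ δ₁ by rw [← hg, Category.id_comp])
  obtain ⟨i, hi⟩ : ∃ i : H ⟶ Y, b ≫ ζ = v ≫ i := Triangle.yoneda_exact₂ _ hE (b ≫ ζ) (show u ≫ b ≫ ζ = 0 by
    rw [reassoc_of% hb1, hζ])
  refine ⟨i, fun W hW ξ t ht => ?_⟩
  have h3 : v ≫ (i ≫ ξ - t) = 0 := by
    rw [Preadditive.comp_sub, ← Category.assoc, ← hi, Category.assoc, ht, ← Category.assoc,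
      ← hb2, Category.comp_id, sub_self]
  obtain ⟨r, hr⟩ : ∃ r : B⟦(1 : ℤ)⟧ ⟶ W, i ≫ ξ - t = g ≫ r := Triangle.yoneda_exact₃ _ hE _ h3
  rw [hW r, comp_zero, sub_eq_zero] at hr
  exact hr

lemma tri_retraction {A B K Z H Y : D} (m : K ⟶ A) (f : A ⟶ B) (δ₂ : B ⟶ K⟦(1 : ℤ)⟧)
    (h₂ : Triangle.mk m f δ₂ ∈ distTriang D)
    (ι : H ⟶ Z) (π : Z ⟶ K) (δ₁ : K ⟶ H⟦(1 : ℤ)⟧) (h₁ : Triangle.mk ι π δ₁ ∈ distTriang D)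
    (hz : ∀ x : B ⟶ H⟦(1 : ℤ)⟧⟦(1 : ℤ)⟧, x = 0) (ξ : Y ⟶ Z) (hξ : ξ ≫ π ≫ m = 0) :
    ∃ p : Y ⟶ H, ∀ (W : D) (_ : ∀ r : W⟦(1 : ℤ)⟧ ⟶ A, r = 0) (j : W ⟶ Y) (t : W ⟶ H),
      j ≫ ξ = t ≫ ι → j ≫ p = t := by
  obtain ⟨g, hg⟩ := tri_extend m f δ₂ h₂ δ₁ (hz _)
  obtain ⟨E, u, v, hE⟩ := distinguished_cocone_triangle₂ g
  obtain ⟨b, hb1, hb2⟩ : ∃ b : Z ⟶ E, ι ≫ b = 𝟙 _ ≫ u ∧ π ≫ m = b ≫ v :=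
    complete_distinguished_triangle_morphism₂ _ _ h₁ hE
    (𝟙 _) m (show δ₁ ≫ (𝟙 H)⟦(1 : ℤ)⟧' = m ≫ g by rw [CategoryTheory.Functor.map_id, ← hg, Category.comp_id])
  obtain ⟨p, hp⟩ : ∃ p : Y ⟶ H, ξ ≫ b = p ≫ u := Triangle.coyoneda_exact₂ _ hE (ξ ≫ b) (show (ξ ≫ b) ≫ v = 0 by
    rw [Category.assoc, ← hb2, hξ])
  refine ⟨p, fun W hW j t ht => ?_⟩
  have h3 : (j ≫ p - t) ≫ u = 0 := by
    rw [Preadditive.sub_comp, Category.assoc, ← hp, ← Category.assoc, ht, Category.assoc, hb1,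
      Category.id_comp, sub_self]
  have h4 : (j ≫ p - t)⟦(1 : ℤ)⟧' ≫ u⟦(1 : ℤ)⟧' = 0 := by
    rw [← Functor.map_comp, h3, Functor.map_zero]
  obtain ⟨r, hr⟩ : ∃ r : W⟦(1 : ℤ)⟧ ⟶ A, (j ≫ p - t)⟦(1 : ℤ)⟧' = r ≫ g :=
    Triangle.coyoneda_exact₁ _ hE ((j ≫ p - t)⟦(1 : ℤ)⟧') h4
  rw [hW r, zero_comp] at hr
  exact sub_eq_zero.1 ((shiftFunctor D (1 : ℤ)).map_injective
    (hr.trans (Functor.map_zero _ _ _).symm))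

end TriAux



section Splitting

open Pretriangulated DerivedCategory

variable {C : Type u₁} [Category.{v₁} C] [Abelian C] [HasDerivedCategory.{w} C]

lemma single_hom_neg (A B : C) (n : ℤ) (hn : n < 0)
    (f : (singleFunctor C 0).obj A ⟶ ((singleFunctor C 0).obj B)⟦n⟧) : f = 0 :=
  TStructure.t.zero_of_isLE_of_isGE f 0 (-n) (by lia) inferInstance
    (TStructure.t.isGE_shift _ 0 n (-n) (by lia))

lemma single_shift_one_hom (A B : C)
    (f : ((singleFunctor C 0).obj A)⟦(1 : ℤ)⟧ ⟶ (singleFunctor C 0).obj B) : f = 0 :=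
  TStructure.t.zero_of_isLE_of_isGE f (-1) 0 (by lia)
    (TStructure.t.isLE_shift _ 0 1 (-1) (by lia)) inferInstance

lemma hom_shift_two_zero (hH : Hereditary C) {A B : C}
    (f : (singleFunctor C 0).obj A ⟶ ((singleFunctor C 0).obj B)⟦(1 : ℤ)⟧⟦(1 : ℤ)⟧) : f = 0 := by
  have h := hH A B 2 le_rfl
  let e := (shiftFunctorAdd' (DerivedCategory C) (1 : ℤ) 1 2 (by norm_num)).app
    ((singleFunctor C 0).obj B)
  have h2 : f ≫ e.inv = 0 := by
    by_contra hne
    exact h ⟨f ≫ e.inv, hne⟩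
  rw [← cancel_mono e.inv, h2, zero_comp]

lemma exists_section (hH : Hereditary C) {Y : DerivedCategory C} (S : ShortComplex C)
    (hS : S.Exact) [Epi S.g] (ζ : (singleFunctor C 0).obj S.X₂ ⟶ Y)
    (hζ : (singleFunctor C 0).map S.f ≫ ζ = 0) :
    ∃ i : (singleFunctor C 0).obj S.X₃ ⟶ Y, ∀ (A : C) (ξ : Y ⟶ (singleFunctor C 0).obj A)
      (t : S.X₃ ⟶ A), ζ ≫ ξ = (singleFunctor C 0).map (S.g ≫ t) →
        i ≫ ξ = (singleFunctor C 0).map t := by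
  let q : S.X₁ ⟶ kernel S.g := kernel.lift S.g S.f S.zero
  have : Epi q := hS.epi_kernelLift
  let S1 : ShortComplex C := ShortComplex.mk (kernel.ι S.g) S.g (kernel.condition _)
  have h1 : S1.ShortExact := 
    { exact := ShortComplex.exact_kernel S.g
      mono_f := by dsimp [S1]; infer_instance
      epi_g := by dsimp [S1]; infer_instance }
  let S2 : ShortComplex C := ShortComplex.mk (kernel.ι q) q (kernel.condition _)
  have h2 : S2.ShortExact := 
    { exact := ShortComplex.exact_kernel q
      mono_f := by dsimp [S2]; infer_instance
      epi_g := by dsimp [S2]; infer_instance }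
  obtain ⟨i, hi⟩ := tri_section _ _ _ h2.singleTriangle_distinguished _ _ _
    h1.singleTriangle_distinguished (fun x => hom_shift_two_zero hH x) ζ (by
      change (singleFunctor C 0).map q ≫ (singleFunctor C 0).map (kernel.ι S.g) ≫ ζ = 0
      rw [← Functor.map_comp_assoc, kernel.lift_ι, hζ])
  exact ⟨i, fun A ξ t ht => hi _ (fun r => single_shift_one_hom _ _ r) ξ _
    (ht.trans (Functor.map_comp _ _ _))⟩

lemma exists_retraction (hH : Hereditary C) {Y : DerivedCategory C} (S : ShortComplex C)
    (hS : S.Exact) [Mono S.f] (ξ : Y ⟶ (singleFunctor C 0).obj S.X₂)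
    (hξ : ξ ≫ (singleFunctor C 0).map S.g = 0) :
    ∃ p : Y ⟶ (singleFunctor C 0).obj S.X₁, ∀ (W : C) (j : (singleFunctor C 0).obj W ⟶ Y)
      (t : W ⟶ S.X₁), j ≫ ξ = (singleFunctor C 0).map (t ≫ S.f) →
        j ≫ p = (singleFunctor C 0).map t := by
  let m : cokernel S.f ⟶ S.X₃ := cokernel.desc S.f S.g S.zero
  have : Mono m := hS.mono_cokernelDesc
  let S1 : ShortComplex C := ShortComplex.mk S.f (cokernel.π S.f) (cokernel.condition _)
  have h1 : S1.ShortExact := 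
    { exact := ShortComplex.exact_cokernel S.f
      mono_f := by dsimp [S1]; infer_instance
      epi_g := by dsimp [S1]; infer_instance }
  let S2 : ShortComplex C := ShortComplex.mk m (cokernel.π m) (cokernel.condition _)
  have h2 : S2.ShortExact := 
    { exact := ShortComplex.exact_cokernel m
      mono_f := by dsimp [S2]; infer_instance
      epi_g := by dsimp [S2]; infer_instance }
  obtain ⟨p, hp⟩ := tri_retraction _ _ _ h2.singleTriangle_distinguished _ _ _
    h1.singleTriangle_distinguished (fun x => hom_shift_two_zero hH x) ξ (by
      change ξ ≫ (singleFunctor C 0).map (cokernel.π S.f) ≫ (singleFunctor C 0).map m = 0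
      rw [← Functor.map_comp, cokernel.π_desc, hξ])
  exact ⟨p, fun A j t ht => hp _ (fun r => single_shift_one_hom _ _ r) j _
    (ht.trans (Functor.map_comp _ _ _))⟩

lemma exists_retract_complex (hH : Hereditary C) (K : CochainComplex C ℤ) :
    ∃ (i : (singleFunctor C 0).obj (K.homology 0) ⟶ Q.obj K)
      (p : Q.obj K ⟶ (singleFunctor C 0).obj (K.homology 0)), i ≫ p = 𝟙 _ := by
  let ζ' : (HomologicalComplex.single C (.up ℤ) 0).obj (K.cycles 0) ⟶ K :=
    HomologicalComplex.mkHomFromSingle (K.iCycles 0) (by simp)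
  let ξ' : K ⟶ (HomologicalComplex.single C (.up ℤ) 0).obj (K.opcycles 0) :=
    HomologicalComplex.mkHomToSingle (K.pOpcycles 0) (by simp)
  let ζ : (singleFunctor C 0).obj (K.cycles 0) ⟶ Q.obj K := Q.map ζ'
  let ξ : Q.obj K ⟶ (singleFunctor C 0).obj (K.opcycles 0) := Q.map ξ'
  have hmap : ∀ {A B : C} (f : A ⟶ B), (singleFunctor C 0).map f =
      Q.map ((HomologicalComplex.single C (.up ℤ) 0).map f) := fun f => rfl
  have hζ : (singleFunctor C 0).map (K.toCycles (-1) 0) ≫ ζ = 0 := by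
    have : Homotopy ((HomologicalComplex.single C (.up ℤ) 0).map (K.toCycles (-1) 0) ≫ ζ') 0 := by
      refine Homotopy.trans (Homotopy.ofEq ?_) (Homotopy.nullHomotopy' (fun i j hij => 
        if h : i = 0 then (((HomologicalComplex.single C (.up ℤ) 0).obj (K.X (-1))).XIsoOfEq h).hom
          ≫ (HomologicalComplex.singleObjXSelf (.up ℤ) 0 (K.X (-1))).hom ≫ 
          (K.XIsoOfEq (show -1 = j by simp at hij; lia)).hom else 0))
      apply HomologicalComplex.from_single_hom_ext
      rw [Homotopy.nullHomotopicMap'_f (show (ComplexShape.up ℤ).Rel (-1) 0 by simp)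
        (show (ComplexShape.up ℤ).Rel 0 1 by simp)]
      simp [ζ', HomologicalComplex.single_map_f_self]
    have := Q_map_eq_of_homotopy _ this
    rw [Functor.map_comp, Functor.map_zero] at this
    exact this
  have hξ : ξ ≫ (singleFunctor C 0).map (K.fromOpcycles 0 1) = 0 := by
    have : Homotopy (ξ' ≫ (HomologicalComplex.single C (.up ℤ) 0).map (K.fromOpcycles 0 1)) 0 := by
      refine Homotopy.trans (Homotopy.ofEq ?_) (Homotopy.nullHomotopy' (fun i j hij => 
        if h : j = 0 then (K.XIsoOfEq (show i = 1 by simp at hij; lia)).hom ≫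
          (HomologicalComplex.singleObjXSelf (.up ℤ) 0 (K.X 1)).inv ≫
          (((HomologicalComplex.single C (.up ℤ) 0).obj (K.X 1)).XIsoOfEq h).inv else 0))
      apply HomologicalComplex.to_single_hom_ext
      rw [Homotopy.nullHomotopicMap'_f (show (ComplexShape.up ℤ).Rel (-1) 0 by simp)
        (show (ComplexShape.up ℤ).Rel 0 1 by simp)]
      simp [ξ', HomologicalComplex.single_map_f_self]
    have := Q_map_eq_of_homotopy _ this
    rw [Functor.map_comp, Functor.map_zero] at this
    exact this
  have hcomp : ζ ≫ ξ = (singleFunctor C 0).map (K.homologyπ 0 ≫ K.homologyι 0) := by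
    have h0 : ζ' ≫ ξ' = (HomologicalComplex.single C (.up ℤ) 0).map
        (K.homologyπ 0 ≫ K.homologyι 0) := by
      apply HomologicalComplex.from_single_hom_ext
      simp [ζ', ξ', HomologicalComplex.single_map_f_self]
    exact (Q.map_comp ζ' ξ').symm.trans (congrArg Q.map h0)
  obtain ⟨i, hi⟩ := exists_section hH
    (ShortComplex.mk (K.toCycles (-1) 0) (K.homologyπ 0) (K.toCycles_comp_homologyπ (-1) 0))
    (ShortComplex.exact_of_g_is_cokernel _ (K.homologyIsCokernel (-1) 0 (by simp))) ζ hζ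
  obtain ⟨p, hp⟩ := exists_retraction hH
    (ShortComplex.mk (K.homologyι 0) (K.fromOpcycles 0 1) (K.homologyι_comp_fromOpcycles 0 1))
    (ShortComplex.exact_of_f_is_kernel _ (K.homologyIsKernel 0 1 (by simp))) ξ hξ
  refine ⟨i, p, ?_⟩
  have := hp _ i (𝟙 _) (by
    rw [hi _ ξ (K.homologyι 0) hcomp]; simp)
  simpa using this

lemma exists_retract (hH : Hereditary C) (Y : DerivedCategory C) :
    ∃ (h : C) (i : (singleFunctor C 0).obj h ⟶ Y) (p : Y ⟶ (singleFunctor C 0).obj h),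
      i ≫ p = 𝟙 _ ∧ Nonempty (h ≅ (homologyFunctor C 0).obj Y) := by
  let K := Q.objPreimage Y
  let e : Q.obj K ≅ Y := Q.objObjPreimageIso Y
  obtain ⟨i, p, hip⟩ := exists_retract_complex hH K
  exact ⟨K.homology 0, i ≫ e.hom, e.inv ≫ p, by simpa using hip,
    ⟨((homologyFunctorFactors C 0).app K).symm ≪≫ (homologyFunctor C 0).mapIso e⟩⟩

end Splitting

section Bricks

open DerivedCategory

variable {C : Type u₁} [Category.{v₁} C] [Abelian C]

/-- A nonzero object without nontrivial idempotents. -/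
def Brick (B : C) : Prop := ¬ IsZero B ∧ ∀ p : B ⟶ B, p ≫ p = p → p = 0 ∨ p = 𝟙 B

lemma brick_of_indecomposable' (Q : C) (h0 : ¬ IsZero Q)
    (h : ∀ (Y Z : C), (Q ≅ Y ⊞ Z) → IsZero Y ∨ IsZero Z) : Brick Q := by
  refine ⟨h0, fun p hp => ?_⟩
  obtain ⟨R, i, r, h1, h2⟩ := IsIdempotentComplete.idempotents_split Q p hp
  obtain ⟨R', i', r', h1', h2'⟩ := IsIdempotentComplete.idempotents_split Q (𝟙 Q - p)
    (Idempotents.idem_of_id_sub_idem p hp)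
  have hi : i ≫ p = i := by rw [← h2, reassoc_of% h1]
  have hr : p ≫ r = r := by rw [← h2, Category.assoc, h1, Category.comp_id]
  have hi' : i' ≫ (𝟙 Q - p) = i' := by rw [← h2', reassoc_of% h1']
  have hr' : (𝟙 Q - p) ≫ r' = r' := by rw [← h2', Category.assoc, h1', Category.comp_id]
  have hz : i ≫ r' = 0 := by
    rw [← hi, ← hr', Category.assoc, ← Category.assoc p, Preadditive.comp_sub, hp]; simp
  have hz' : i' ≫ r = 0 := by
    rw [← hi', ← hr, Category.assoc, ← Category.assoc _ p, Preadditive.sub_comp, hp]; simp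
  have e : Q ≅ R ⊞ R' :=
    { hom := biprod.lift r r'
      inv := biprod.desc i i'
      hom_inv_id := by rw [biprod.lift_desc, h2, h2']; simp
      inv_hom_id := by
        ext <;> simp [h1, h1', hz, hz'] }
  rcases h R R' e with h' | h'
  · left
    rw [← h2, h'.eq_of_tgt r 0, zero_comp]
  · right
    have : 𝟙 Q - p = 0 := by rw [← h2', h'.eq_of_tgt r' 0, zero_comp]
    exact (sub_eq_zero.1 this).symm

lemma brick_of_indecomposable [inst : HasZeroMorphisms C] [i2 : @HasBinaryBiproducts C _ inst] (Q : C)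
    (h : @Indecomposable C _ inst i2 Q) : Brick Q := by
  obtain rfl : inst = Preadditive.preadditiveHasZeroMorphisms := Subsingleton.elim _ _
  refine brick_of_indecomposable' Q h.1 (fun Y Z e => h.2 Y Z (e ≪≫ ?_))
  exact biprod.uniqueUpToIso _ _ (BinaryBiproduct.isBilimit Y Z)

lemma exists_brick_retract (Q : C)
    (hwf : WellFounded (fun p q : {p : Q ⟶ Q // p ≫ p = p} =>
      p.1 ≫ q.1 = p.1 ∧ q.1 ≫ p.1 = p.1 ∧ p ≠ q))
    (Φ : (Q ⟶ Q) → Prop) (h1 : Φ (𝟙 Q)) (h0 : ¬ Φ 0)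
    (hadd : ∀ p q, Φ (p + q) → Φ p ∨ Φ q) :
    ∃ (R : C) (i : R ⟶ Q) (r : Q ⟶ R), i ≫ r = 𝟙 R ∧ Φ (r ≫ i) ∧ Brick R := by
  obtain ⟨⟨p, hp⟩, hpΦ, hmin⟩ := hwf.has_min {p | Φ p.1} ⟨⟨𝟙 Q, by simp⟩, h1⟩
  obtain ⟨R, i, r, hir, hri⟩ := IsIdempotentComplete.idempotents_split Q p hp
  have key : ∀ e : R ⟶ R, e ≫ e = e → Φ (r ≫ e ≫ i) → e = 𝟙 R := by
    intro e he hΦ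
    by_contra hne
    refine hmin ⟨r ≫ e ≫ i, by simp [reassoc_of% hir, reassoc_of% he]⟩ hΦ ⟨?_, ?_, ?_⟩
    · simp [← hri, reassoc_of% hir]
    · simp [← hri, reassoc_of% hir]
    · intro heq
      have heq' : r ≫ e ≫ i = p := congrArg Subtype.val heq
      apply hne
      have : i ≫ (r ≫ e ≫ i) ≫ r = i ≫ p ≫ r := by rw [heq']
      simpa [← hri, reassoc_of% hir, hir] using this
  refine ⟨R, i, r, hir, by rw [hri]; exact hpΦ, ?_, fun e he => ?_⟩
  · intro hz
    apply h0
    have : p = 0 := by rw [← hri, hz.eq_of_tgt r 0, zero_comp]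
    rw [← this]; exact hpΦ
  · have hsum : r ≫ e ≫ i + r ≫ (𝟙 R - e) ≫ i = p := by
      simp [← hri]
    rcases hadd (r ≫ e ≫ i) (r ≫ (𝟙 R - e) ≫ i) (by rw [hsum]; exact hpΦ) with h | h
    · exact Or.inr (key e he h)
    · have := key _ (Idempotents.idem_of_id_sub_idem e he) h
      left
      simpa using this

variable [HasDerivedCategory.{w} C]

lemma extNonzero_zero {A B : C} (f : A ⟶ B) (hf : f ≠ 0) : extNonzero C A B 0 := by
  let e := (shiftFunctorZero (DerivedCategory C) ℤ).app ((singleFunctor C 0).obj B)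
  refine ⟨(singleFunctor C 0).map f ≫ e.inv, fun h => hf ?_⟩
  have h2 : (singleFunctor C 0).map f = 0 := by
    rw [← cancel_mono e.inv, h, zero_comp]
  exact (singleFunctor C 0).map_injective (h2.trans (Functor.map_zero _ _ _).symm)

/-- Every object satisfies the minimum condition for idempotents. -/
def IdemMin (C : Type u₁) [Category.{v₁} C] : Prop :=
  ∀ Q : C, WellFounded (fun p q : {p : Q ⟶ Q // p ≫ p = p} =>
      p.1 ≫ q.1 = p.1 ∧ q.1 ≫ p.1 = p.1 ∧ p ≠ q)

lemma reduce_left (hwf : IdemMin C) {Q Q' : C} {i : ℤ} (h : extNonzero C Q Q' i) :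
    ∃ B : C, Brick B ∧ extNonzero C B Q' i := by
  obtain ⟨α, hα⟩ := h
  obtain ⟨R, j, r, hjr, hΦ, hR⟩ := exists_brick_retract Q (hwf Q)
    (fun p => (singleFunctor C 0).map p ≫ α ≠ 0) (by simpa using hα) (by simp)
    (fun p q => by
      rw [Functor.map_add, Preadditive.add_comp]
      intro h
      by_contra! h'
      exact h (by rw [h'.1, h'.2, add_zero]))
  refine ⟨R, hR, (singleFunctor C 0).map j ≫ α, fun h => hΦ ?_⟩
  rw [Functor.map_comp, Category.assoc, h, comp_zero]

lemma reduce_right (hwf : IdemMin C) {Q Q' : C} {i : ℤ} (h : extNonzero C Q Q' i) :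
    ∃ B : C, Brick B ∧ extNonzero C Q B i := by
  obtain ⟨α, hα⟩ := h
  obtain ⟨R, j, r, hjr, hΦ, hR⟩ := exists_brick_retract Q' (hwf Q')
    (fun p => α ≫ ((singleFunctor C 0).map p)⟦i⟧' ≠ 0) (by simpa using hα) (by simp)
    (fun p q => by
      rw [Functor.map_add, Functor.map_add, Preadditive.comp_add]
      intro h
      by_contra! h'
      exact h (by rw [h'.1, h'.2, add_zero]))
  refine ⟨R, hR, α ≫ ((singleFunctor C 0).map r)⟦i⟧', fun h => hΦ ?_⟩
  rw [Functor.map_comp, Functor.map_comp, ← Category.assoc, h, zero_comp]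

lemma linear_comm {R : Type*} [Ring R] [Linear R C] (e : R) {B B' : C} {i : ℤ}
    (α : (singleFunctor C 0).obj B ⟶ ((singleFunctor C 0).obj B')⟦i⟧) (f : B ⟶ B) (g : B' ⟶ B')
    (hf : f = e • 𝟙 B) (hg : g = e • 𝟙 B') :
    (singleFunctor C 0).map f ≫ α = α ≫ ((singleFunctor C 0).map g)⟦i⟧' := by
  rw [hf, hg, CategoryTheory.Functor.map_smul, CategoryTheory.Functor.map_smul,
    CategoryTheory.Functor.map_smul]
  simp

lemma center_comm (e : CatCenter C) {B B' : C} {i : ℤ}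
    (α : (singleFunctor C 0).obj B ⟶ ((singleFunctor C 0).obj B')⟦i⟧) :
    (singleFunctor C 0).map (e.app B) ≫ α = α ≫ ((singleFunctor C 0).map (e.app B'))⟦i⟧' :=
  @linear_comm C _ _ _ (CatCenter C) _ (Linear.ofRingMorphism (RingHom.id _)) e B B' i α _ _
    (Category.comp_id (e.app B)).symm (Category.comp_id (e.app B')).symm

lemma center_transfer (e : CatCenter C) {B B' : C} {i : ℤ} (hB' : Brick B')
    (he : e * e = e) (h1 : e.app B = 𝟙 B) (h : extNonzero C B B' i) : e.app B' = 𝟙 B' := by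
  obtain ⟨α, hα⟩ := h
  have hid : e.app B' ≫ e.app B' = e.app B' := by
    conv_rhs => rw [← he]
    rw [CatCenter.mul_app]
  rcases hB'.2 _ hid with h | h
  · exfalso
    apply hα
    have := center_comm e α
    rw [h1, h] at this
    simpa using this
  · exact h

end Bricks

section Degrees

open DerivedCategory ZeroObject

variable {C : Type u₁} [Category.{v₁} C] [Abelian C] [HasDerivedCategory.{w} C]
variable {ℋ : Type u'} [Category.{v'} ℋ] [Abelian ℋ] [HasDerivedCategory.{w'} ℋ]

/-- `B` has degree `n` if `F(B)[n]` is concentrated in degree zero. -/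
def HasDeg (F : DerivedCategory C ⥤ DerivedCategory ℋ) (B : C) (n : ℤ) : Prop :=
  ∃ h : ℋ, Nonempty ((F.obj ((singleFunctor C 0).obj B))⟦n⟧ ≅ (singleFunctor ℋ 0).obj h)

lemma isZero_of_homology (Y : DerivedCategory ℋ)
    (h : ∀ n : ℤ, IsZero ((homologyFunctor ℋ 0).obj (Y⟦n⟧))) : IsZero Y := by
  have : IsIso (0 : Y ⟶ 0) := by
    rw [DerivedCategory.isIso_iff]
    intro n
    have h1 : IsZero ((homologyFunctor ℋ n).obj Y) :=
      (h n).of_iso (((homologyFunctor ℋ 0).shiftIso n 0 n (by simp)).app Y).symm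
    have h2 : IsZero ((homologyFunctor ℋ n).obj (0 : DerivedCategory ℋ)) :=
      Functor.map_isZero _ (isZero_zero _)
    exact ⟨0, h1.eq_of_src _ _, h2.eq_of_src _ _⟩
  exact (isZero_zero _).of_iso (asIso (0 : Y ⟶ 0))

lemma exists_deg (hH : Hereditary ℋ) (F : DerivedCategory C ⥤ DerivedCategory ℋ)
    [F.IsEquivalence] (B : C) (hB : Brick B) : ∃ n, HasDeg F B n := by
  obtain ⟨n, hn⟩ : ∃ n : ℤ, ¬ IsZero ((homologyFunctor ℋ 0).obj
      ((F.obj ((singleFunctor C 0).obj B))⟦n⟧)) := by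
    by_contra! hcon
    have h1 := isZero_of_homology _ hcon
    have h2 : (𝟙 B) = 0 := by
      apply (singleFunctor C 0 ⋙ F).map_injective
      exact h1.eq_of_src _ _
    exact hB.1 ((IsZero.iff_id_eq_zero B).2 h2)
  refine ⟨n, ?_⟩
  obtain ⟨h, i, p, hip, ⟨eh⟩⟩ := exists_retract hH ((F.obj ((singleFunctor C 0).obj B))⟦n⟧)
  refine ⟨h, ?_⟩
  let G : C ⥤ DerivedCategory ℋ := (singleFunctor C 0 ⋙ F) ⋙ shiftFunctor (DerivedCategory ℋ) n
  let i' : (singleFunctor ℋ 0).obj h ⟶ G.obj B := i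
  let p' : G.obj B ⟶ (singleFunctor ℋ 0).obj h := p
  have hip' : i' ≫ p' = 𝟙 _ := hip
  obtain ⟨e, he⟩ := G.map_surjective (p' ≫ i')
  have hid : e ≫ e = e := by
    apply G.map_injective
    rw [G.map_comp, he, Category.assoc, reassoc_of% hip']
  rcases hB.2 e hid with h0 | h1
  · exfalso
    apply hn
    refine IsZero.of_iso ?_ eh.symm
    rw [IsZero.iff_id_eq_zero]
    apply (singleFunctor ℋ 0).map_injective
    have h3 : p' ≫ i' = 0 := by
      have : e = e ≫ 0 ≫ e := by rw [zero_comp, comp_zero, h0]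
      rw [← he, h0]
      have hz : IsZero (G.obj (0 : C)) := by
        have hz1 : IsZero ((singleFunctor C 0).obj (0 : C)) :=
          Functor.map_isZero _ (isZero_zero _)
        have hz2 : IsZero (F.obj ((singleFunctor C 0).obj (0 : C))) := by
          exact Functor.map_isZero F hz1
        exact Functor.map_isZero (shiftFunctor (DerivedCategory ℋ) n) hz2
      have : (0 : B ⟶ B) = (0 : B ⟶ 0) ≫ (0 : (0 : C) ⟶ B) := by simp
      rw [this, G.map_comp, hz.eq_of_tgt (G.map (0 : B ⟶ 0)) 0, zero_comp]
    rw [CategoryTheory.Functor.map_id, Functor.map_zero, ← hip', ← Category.comp_id (i' ≫ p'), ← hip',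
      Category.assoc, reassoc_of% h3]
    simp
  · exact ⟨⟨p', i', by rw [← he, h1, G.map_id]; rfl, hip'⟩⟩

lemma deg_bound (hH : Hereditary ℋ) (F : DerivedCategory C ⥤ DerivedCategory ℋ)
    [F.IsEquivalence] [F.CommShift ℤ] {B B' : C} {a b i : ℤ} (ha : HasDeg F B a)
    (hb : HasDeg F B' b) (h : extNonzero C B B' i) : 0 ≤ i + a - b ∧ i + a - b ≤ 1 := by
  obtain ⟨h₁, ⟨e₁⟩⟩ := ha
  obtain ⟨h₂, ⟨e₂⟩⟩ := hb
  obtain ⟨α, hα⟩ := h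
  let SB' := (singleFunctor C 0).obj B'
  let c : (F.obj (SB'⟦i⟧))⟦a⟧ ≅ ((singleFunctor ℋ 0).obj h₂)⟦i + a - b⟧ :=
    (shiftFunctor _ a).mapIso ((F.commShiftIso i).app SB') ≪≫
    ((shiftFunctorAdd' _ i a (i + a) rfl).app (F.obj SB')).symm ≪≫
    ((shiftFunctorAdd' _ b (i + a - b) (i + a) (by lia)).app (F.obj SB')) ≪≫
    (shiftFunctor _ (i + a - b)).mapIso e₂
  let β : (singleFunctor ℋ 0).obj h₁ ⟶ ((singleFunctor ℋ 0).obj h₂)⟦i + a - b⟧ :=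
    e₁.inv ≫ (F.map α)⟦a⟧' ≫ c.hom
  have hβ : β ≠ 0 := by
    intro h0
    apply hα
    have h1 : (F.map α)⟦a⟧' = 0 := by
      rw [← cancel_epi e₁.inv, ← cancel_mono c.hom, Category.assoc, comp_zero, zero_comp]
      exact h0
    have h2 := (shiftFunctor _ a).map_injective (h1.trans (Functor.map_zero _ _ _).symm)
    exact F.map_injective (h2.trans (Functor.map_zero _ _ _).symm)
  constructor
  · by_contra! hlt
    exact hβ (single_hom_neg _ _ _ hlt β)
  · by_contra! hlt
    obtain ⟨d, hd⟩ := Int.eq_ofNat_of_zero_le (show 0 ≤ i + a - b by lia)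
    refine hH h₁ h₂ d (by lia) ?_
    rw [← hd]
    exact ⟨β, hβ⟩

/-- `B` and `V` receive nonzero maps from a common brick and have nonzero maps to
a common brick. -/
def Linked (B V : C) : Prop :=
  (∃ (P : C) (f : P ⟶ B) (g : P ⟶ V), Brick P ∧ f ≠ 0 ∧ g ≠ 0) ∧
  (∃ (I : C) (f : B ⟶ I) (g : V ⟶ I), Brick I ∧ f ≠ 0 ∧ g ≠ 0)

lemma deg_link (hH : Hereditary ℋ) (F : DerivedCategory C ⥤ DerivedCategory ℋ)
    [F.IsEquivalence] [F.CommShift ℤ] {B V : C} {a b : ℤ} (ha : HasDeg F B a)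
    (hb : HasDeg F V b) (h : Linked B V) : a ≤ b + 1 ∧ b - 1 ≤ a := by
  obtain ⟨⟨P, f, g, hP, hf, hg⟩, ⟨I, f', g', hI, hf', hg'⟩⟩ := h
  obtain ⟨p, hp⟩ := exists_deg hH F P hP
  obtain ⟨q, hq⟩ := exists_deg hH F I hI
  have h1 := deg_bound hH F hp ha (extNonzero_zero f hf)
  have h2 := deg_bound hH F hp hb (extNonzero_zero g hg)
  have h3 := deg_bound hH F ha hq (extNonzero_zero f' hf')
  have h4 := deg_bound hH F hb hq (extNonzero_zero g' hg')
  lia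

theorem abstract_main (hph : IsPiecewiseHereditary.{w, w', v', u', v₁, u₁} C)
    (hwf : IdemMin C) {ι : Type*} (e : ι → CatCenter C) (he : ∀ c, e c * e c = e c)
    (V : ι → C) (hV : ∀ c, Brick (V c)) (hex : ∀ B : C, Brick B → ∃ c, (e c).app B ≠ 0)
    (hlink : ∀ (B : C) (c : ι), Brick B → (e c).app B ≠ 0 → Linked B (V c)) :
    gldim C ≤ 3 ∧ ∀ Q : C, Brick Q → projDim C Q + injDim C Q ≤ 4 := by
  obtain ⟨ℋ, _, _, _, hH, ⟨⟨F, hF, hcs, -⟩⟩⟩ := hph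
  have hone : ∀ (B : C) (c : ι), Brick B → (e c).app B ≠ 0 → (e c).app B = 𝟙 B := by
    intro B c hB h
    refine (hB.2 _ ?_).resolve_left h
    conv_rhs => rw [← he]
    rw [CatCenter.mul_app]
  have hnz : ∀ (B : C) (c : ι), Brick B → (e c).app B = 𝟙 B → (e c).app B ≠ 0 := by
    intro B c hB h h'
    exact hB.1 ((IsZero.iff_id_eq_zero B).2 (h.symm.trans h'))
  constructor
  · refine iSup_le fun Q => iSup_le fun d => iSup_le fun hd => ?_
    obtain ⟨Q', hd⟩ := hd
    obtain ⟨B, hB, hd⟩ := reduce_left hwf hd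
    obtain ⟨B', hB', hd⟩ := reduce_right hwf hd
    obtain ⟨c, hc⟩ := hex B hB
    have hc' := hnz _ _ hB' (center_transfer (e c) hB' (he c) (hone _ _ hB hc) hd)
    obtain ⟨a, ha⟩ := exists_deg hH F B hB
    obtain ⟨a', ha'⟩ := exists_deg hH F B' hB'
    obtain ⟨v, hv⟩ := exists_deg hH F (V c) (hV c)
    have h1 := deg_link hH F ha hv (hlink _ _ hB hc)
    have h2 := deg_link hH F ha' hv (hlink _ _ hB' hc')
    have h3 := deg_bound hH F ha ha' hd
    have : d ≤ 3 := by lia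
    exact_mod_cast this
  · intro Q hQ
    obtain ⟨a, ha⟩ := exists_deg hH F Q hQ
    have hQQ : extNonzero C Q Q ((0 : ℕ) : ℤ) := extNonzero_zero (𝟙 Q)
      (fun h => hQ.1 ((IsZero.iff_id_eq_zero Q).2 h))
    refine ENat.biSup_add_biSup_le' ⟨0, Q, hQQ⟩ ⟨0, Q, hQQ⟩ ?_
    rintro i ⟨Q', hi⟩ j ⟨Q'', hj⟩
    obtain ⟨B', hB', hi⟩ := reduce_right hwf hi
    obtain ⟨B'', hB'', hj⟩ := reduce_left hwf hj
    obtain ⟨c'', hc''⟩ := hex B'' hB''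
    have hcQ := hnz _ _ hQ (center_transfer (e c'') hQ (he c'') (hone _ _ hB'' hc'') hj)
    have hi2 := center_transfer (e c'') hB' (he c'') (hone _ _ hQ hcQ) hi
    obtain ⟨a', ha'⟩ := exists_deg hH F B' hB'
    obtain ⟨a'', ha''⟩ := exists_deg hH F B'' hB''
    obtain ⟨v, hv⟩ := exists_deg hH F (V c'') (hV c'')
    have h1 := deg_link hH F ha' hv (hlink _ _ hB' (hnz _ _ hB' hi2))
    have h2 := deg_link hH F ha'' hv (hlink _ _ hB'' hc'')
    have h3 := deg_bound hH F ha ha' hi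
    have h4 := deg_bound hH F ha'' ha hj
    have : i + j ≤ 4 := by lia
    exact_mod_cast this

end Degrees

section Concrete

open MulOpposite

variable {K : Type u} [Field K] {P : Type u} [PartialOrder P] [DecidableEq P]
  [LocallyFiniteOrder P]

open scoped Classical in
/-- The element of the incidence algebra with prescribed values. -/
noncomputable def elt (g : P → P → K) : IncidenceAlgebra K P :=
  ⟨fun a b => if a ≤ b then g a b else 0, fun _ _ h => if_neg h⟩

open scoped Classical in
lemma elt_apply (g : P → P → K) (a b : P) : elt g a b = if a ≤ b then g a b else 0 := rfl

/-- The matrix unit `e_{xy}` (zero if `x ≤ y` fails). -/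
noncomputable def unit (x y : P) : IncidenceAlgebra K P :=
  elt (fun a b => if a = x ∧ b = y then 1 else 0)

/-- Diagonal elements. -/
noncomputable def diag (d : P → K) : IncidenceAlgebra K P :=
  elt (fun a b => if a = b then d a else 0)

lemma diag_apply (d : P → K) (a b : P) : diag d a b = if a = b then d a else 0 := by
  unfold diag
  rw [elt_apply]
  by_cases h : a = b
  · subst h; simp
  · simp [h]

lemma mul_diag (f : IncidenceAlgebra K P) (d : P → K) (a b : P) :
    (f * diag d) a b = f a b * d b := by
  rw [IncidenceAlgebra.mul_apply]
  by_cases h : a ≤ b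
  · rw [Finset.sum_eq_single b]
    · simp [diag_apply]
    · intro x _ hx
      simp [diag_apply, hx]
    · intro hb
      simp [h] at hb
  · rw [IncidenceAlgebra.apply_eq_zero_of_not_le h, Finset.Icc_eq_empty h]
    simp

lemma diag_mul (f : IncidenceAlgebra K P) (d : P → K) (a b : P) :
    (diag d * f) a b = d a * f a b := by
  rw [IncidenceAlgebra.mul_apply]
  by_cases h : a ≤ b
  · rw [Finset.sum_eq_single a]
    · simp [diag_apply]
    · intro x _ hx
      simp [diag_apply, Ne.symm hx]
    · intro hb
      simp [h] at hb
  · rw [IncidenceAlgebra.apply_eq_zero_of_not_le h, Finset.Icc_eq_empty h]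
    simp

lemma unit_self (x : P) : (unit x x : IncidenceAlgebra K P) = diag (fun a => if a = x then 1 else 0) := by
  ext a b
  rw [diag_apply]
  unfold unit
  rw [elt_apply]
  grind

/-- Convex subsets. -/
structure CSet (P : Type u) [PartialOrder P] where
  carrier : Set P
  convex : ∀ ⦃x y z⦄, x ∈ carrier → z ∈ carrier → x ≤ y → y ≤ z → y ∈ carrier

variable [Fintype P]

noncomputable instance (S : CSet P) : Fintype S.carrier := Fintype.ofFinite _

lemma mul_univ (f g : IncidenceAlgebra K P) (a b : P) :
    (f * g) a b = ∑ x, f a x * g x b := by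
  rw [IncidenceAlgebra.mul_apply]
  refine Finset.sum_subset (Finset.subset_univ _) (fun x _ hx => ?_)
  rw [Finset.mem_Icc, not_and_or] at hx
  rcases hx with hx | hx
  · rw [IncidenceAlgebra.apply_eq_zero_of_not_le hx, zero_mul]
  · rw [IncidenceAlgebra.apply_eq_zero_of_not_le hx, mul_zero]

open scoped Classical in
lemma sum_cset (S : CSet P) (g : P → K) (hg : ∀ x, x ∉ S.carrier → g x = 0) :
    ∑ x : S.carrier, g x = ∑ x, g x := by
  rw [← Finset.sum_subtype (Finset.univ.filter (· ∈ S.carrier)) (by simp) g]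
  refine Finset.sum_subset (Finset.subset_univ _) (fun x _ hx => hg x (by simpa using hx))

lemma cset_mul_eq_zero (S : CSet P) (f g : IncidenceAlgebra K P) (a b : S.carrier) (x : P)
    (hx : x ∉ S.carrier) : f a x * g x b = 0 := by
  by_cases h1 : a.1 ≤ x
  · by_cases h2 : x ≤ b.1
    · exact absurd (S.convex a.2 b.2 h1 h2) hx
    · rw [IncidenceAlgebra.apply_eq_zero_of_not_le h2, mul_zero]
  · rw [IncidenceAlgebra.apply_eq_zero_of_not_le h1, zero_mul]

variable (K) in
/-- The module `k_S` attached to a convex subset `S`. -/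
def KMod (S : CSet P) : Type u := S.carrier → K

noncomputable instance (S : CSet P) : AddCommGroup (KMod K S) :=
  inferInstanceAs (AddCommGroup (S.carrier → K))

noncomputable instance (S : CSet P) : Module K (KMod K S) :=
  inferInstanceAs (Module K (S.carrier → K))

instance (S : CSet P) : Module.Finite K (KMod K S) :=
  inferInstanceAs (Module.Finite K (S.carrier → K))

noncomputable instance (S : CSet P) : Module (IncidenceAlgebra K P)ᵐᵒᵖ (KMod K S) where
  smul f v := fun y => ∑ x : S.carrier, v x * (unop f) x y
  one_smul v := by
    funext y
    change ∑ x : S.carrier, v x * (1 : IncidenceAlgebra K P) x y = v y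
    rw [Finset.sum_eq_single y]
    · simp
    · intro z _ hz
      have : z.1 ≠ y.1 := fun h => hz (Subtype.ext h)
      simp [IncidenceAlgebra.one_apply, this]
    · simp
  mul_smul f g v := by
    funext z
    change ∑ x : S.carrier, v x * (unop g * unop f) x z =
      ∑ y : S.carrier, (∑ x : S.carrier, v x * (unop g) x y) * (unop f) y z
    simp_rw [Finset.sum_mul]
    rw [Finset.sum_comm]
    refine Finset.sum_congr rfl fun x _ => ?_
    rw [mul_univ, ← sum_cset S _ (fun y hy => cset_mul_eq_zero S _ _ x z y hy), Finset.mul_sum]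
    exact Finset.sum_congr rfl fun y _ => (mul_assoc _ _ _).symm
  smul_zero f := by
    funext y
    change ∑ x : S.carrier, (0 : K) * (unop f) x y = 0
    simp
  smul_add f v w := by
    funext y
    change ∑ x : S.carrier, (v x + w x) * (unop f) x y =
      ∑ x : S.carrier, v x * (unop f) x y + ∑ x : S.carrier, w x * (unop f) x y
    simp_rw [add_mul, Finset.sum_add_distrib]
  add_smul f g v := by
    funext y
    change ∑ x : S.carrier, v x * ((unop f) x y + (unop g) x y) =
      ∑ x : S.carrier, v x * (unop f) x y + ∑ x : S.carrier, v x * (unop g) x y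
    simp_rw [mul_add, Finset.sum_add_distrib]
  zero_smul v := by
    funext y
    change ∑ x : S.carrier, v x * (0 : K) = 0
    simp

lemma kmod_smul_apply (S : CSet P) (f : IncidenceAlgebra K P) (v : KMod K S) (y : S.carrier) :
    (op f • v) y = ∑ x : S.carrier, v x * f x y := rfl

instance (S : CSet P) : IsScalarTower K (IncidenceAlgebra K P)ᵐᵒᵖ (KMod K S) where
  smul_assoc c f v := by
    funext y
    change ∑ x : S.carrier, v x * (c * (unop f) x y) = c * ∑ x : S.carrier, v x * (unop f) x y
    rw [Finset.mul_sum]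
    exact Finset.sum_congr rfl fun x _ => by ring

instance (S : CSet P) : Module.Finite (IncidenceAlgebra K P)ᵐᵒᵖ (KMod K S) :=
  Module.Finite.of_restrictScalars_finite K _ _

open scoped Classical in
/-- Basis vectors of `k_S`. -/
noncomputable def kdelta (S : CSet P) (x : S.carrier) : KMod K S := fun y => if y = x then 1 else 0

lemma kdelta_smul (S : CSet P) (f : IncidenceAlgebra K P) (x y : S.carrier) :
    (op f • (kdelta S x : KMod K S)) y = f x y := by
  rw [kmod_smul_apply]
  simp [kdelta]

lemma kmod_unit_self (S : CSet P) (x : S.carrier) (v : KMod K S) :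
    op (unit x.1 x.1 : IncidenceAlgebra K P) • v = v x • (kdelta S x : KMod K S) := by
  funext y
  rw [kmod_smul_apply]
  change _ = v x * (kdelta S x y)
  rw [unit_self, Finset.sum_eq_single x]
  · simp [diag_apply, kdelta, Subtype.ext_iff, eq_comm]
  · intro z _ hz
    have : z.1 ≠ x.1 := fun h => hz (Subtype.ext h)
    simp [diag_apply, this]
  · simp

lemma kdelta_unit (S : CSet P) (x y : S.carrier) (h : x ≤ y) :
    op (unit x.1 y.1 : IncidenceAlgebra K P) • (kdelta S x : KMod K S) = kdelta S y := by
  funext z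
  rw [kdelta_smul]
  unfold unit
  rw [elt_apply]
  simp only [kdelta, true_and, Subtype.ext_iff]
  have h' : x.1 ≤ y.1 := h
  grind

/-- Every invariant function on `S` is constant. -/
def CSet.Conn (S : CSet P) (K : Type u) : Prop :=
  ∀ c : S.carrier → K, (∀ x y : S.carrier, x ≤ y → c x = c y) → ∀ x y, c x = c y

lemma kmod_endo (S : CSet P) (p : KMod K S →ₗ[(IncidenceAlgebra K P)ᵐᵒᵖ] KMod K S) :
    (∀ v x, p v x = v x * p (kdelta S x) x) ∧
    ∀ x y : S.carrier, x ≤ y → p (kdelta S x) x = p (kdelta S y) y := by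
  have hlin : ∀ (c : K) v, p (c • v) = c • p v := fun c v =>
    (p.restrictScalars K).map_smul c v
  have key : ∀ v x, p v x = v x * p (kdelta S x) x := by
    intro v x
    have h1 : p (op (unit x.1 x.1 : IncidenceAlgebra K P) • v) = op (unit x.1 x.1 : IncidenceAlgebra K P) • p v := p.map_smul _ _
    rw [kmod_unit_self, kmod_unit_self, hlin] at h1
    have h2 := congrFun h1 x
    change v x * _ = p v x * kdelta S x x at h2
    rw [h2]
    simp [kdelta]
  refine ⟨key, fun x y h => ?_⟩
  have h1 : p (op (unit x.1 y.1 : IncidenceAlgebra K P) • kdelta S x) = op (unit x.1 y.1 : IncidenceAlgebra K P) • p (kdelta S x) :=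
    p.map_smul _ _
  rw [kdelta_unit S x y h] at h1
  have h' : x.1 ≤ y.1 := h
  rw [h1, kmod_smul_apply, Finset.sum_eq_single x]
  · have : (unit x.1 y.1 : IncidenceAlgebra K P) x y = 1 := by
      unfold unit
      simp [elt_apply, h']
    rw [this, mul_one]
  · intro z _ hz
    rw [key]
    simp [kdelta, hz]
  · simp

end Concrete

section Concrete2

open MulOpposite

variable {K : Type u} [Field K] {P : Type u} [PartialOrder P] [DecidableEq P]
  [LocallyFiniteOrder P] [Fintype P]

/-- The principal filter of `y`. -/
def upSet (y : P) : CSet P := ⟨{z | y ≤ z}, fun _ _ _ hx _ hxy _ => le_trans hx hxy⟩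

/-- The principal ideal of `y`. -/
def downSet (y : P) : CSet P := ⟨{z | z ≤ y}, fun _ _ _ _ hz _ hyz => le_trans hyz hz⟩

variable (K) in
/-- The connected component of `y`. -/
def compSet (y : P) : Set P :=
  {z | ∀ f : P → K, (∀ a b, a ≤ b → f a = f b) → f y = f z}

lemma compSet_iff (y : P) {a b : P} (h : a ≤ b) : a ∈ compSet K y ↔ b ∈ compSet K y := by
  constructor
  · intro ha f hf
    rw [ha f hf, hf a b h]
  · intro hb f hf
    rw [hb f hf, hf a b h]

variable (K) in
/-- The connected component of `y` as a convex set. -/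
def compCSet (y : P) : CSet P := ⟨compSet K y, fun _ _ _ hx _ hxy _ => (compSet_iff y hxy).1 hx⟩

lemma conn_up (y : P) : (upSet y).Conn K := by
  intro c hc x z
  have h : ∀ w, c ⟨y, le_refl y⟩ = c w := fun w => hc _ _ w.2
  rw [← h x, h z]

lemma conn_down (y : P) : (downSet y).Conn K := by
  intro c hc x z
  have h : ∀ w, c w = c ⟨y, le_refl y⟩ := fun w => hc _ _ w.2
  rw [h x, h z]

open scoped Classical in
lemma conn_comp (y : P) : (compCSet K y).Conn K := by
  intro c hc x z
  let f : P → K := fun w => if h : w ∈ compSet K y then c ⟨w, h⟩ else 0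
  have hf : ∀ a b, a ≤ b → f a = f b := by
    intro a b hab
    by_cases ha : a ∈ compSet K y
    · have hb := (compSet_iff y hab).1 ha
      simp only [f, dif_pos ha, dif_pos hb]
      exact hc _ _ hab
    · have hb : b ∉ compSet K y := fun hb => ha ((compSet_iff y hab).2 hb)
      simp only [f, dif_neg ha, dif_neg hb]
  have hx := x.2 f hf
  have hz := z.2 f hf
  have hfx : f x.1 = c x := dif_pos x.2
  have hfz : f z.1 = c z := dif_pos z.2
  rw [← hfx, ← hfz, ← hx, ← hz]

open scoped Classical in
/-- Row vectors as elements of the incidence algebra. -/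
noncomputable def rowElt (y : P) (v : KMod K (upSet y)) : IncidenceAlgebra K P :=
  elt (fun a b => if h : a = y ∧ y ≤ b then v ⟨b, h.2⟩ else 0)

open scoped Classical in
lemma rowElt_apply (y : P) (v : KMod K (upSet y)) (a b : P) :
    rowElt y v a b = if h : a = y ∧ y ≤ b then v ⟨b, h.2⟩ else 0 := by
  unfold rowElt
  rw [elt_apply]
  grind

lemma rowElt_add (y : P) (v w : KMod K (upSet y)) : rowElt y (v + w) = rowElt y v + rowElt y w := by
  ext a b
  rw [IncidenceAlgebra.add_apply, rowElt_apply, rowElt_apply, rowElt_apply]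
  split_ifs
  · rfl
  · simp

lemma rowElt_smul (y : P) (f : IncidenceAlgebra K P) (v : KMod K (upSet y)) :
    rowElt y (op f • v) = rowElt y v * f := by
  ext a b
  rw [mul_univ, ← sum_cset (upSet y), rowElt_apply]
  · split_ifs with h
    · rw [kmod_smul_apply]
      refine Finset.sum_congr rfl fun x _ => ?_
      rw [rowElt_apply, dif_pos ⟨h.1, x.2⟩]
    · symm
      refine Finset.sum_eq_zero fun x _ => ?_
      rw [rowElt_apply]
      split_ifs with h'
      · have : ¬ x.1 ≤ b := fun h2 => h ⟨h'.1, le_trans h'.2 h2⟩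
        rw [IncidenceAlgebra.apply_eq_zero_of_not_le this, mul_zero]
      · rw [zero_mul]
  · intro x hx
    rw [rowElt_apply, dif_neg (fun h => hx h.2), zero_mul]

/-- The map from the projective module at `y` determined by an element. -/
noncomputable def upMap (y : P) {B : Type u} [AddCommGroup B] [Module (IncidenceAlgebra K P)ᵐᵒᵖ B]
    (b : B) : KMod K (upSet y) →ₗ[(IncidenceAlgebra K P)ᵐᵒᵖ] B where
  toFun v := op (rowElt y v) • b
  map_add' v w := by rw [rowElt_add, MulOpposite.op_add, add_smul]
  map_smul' f v := by
    obtain ⟨f, rfl⟩ := op_surjective f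
    rw [rowElt_smul, MulOpposite.op_mul, mul_smul]
    rfl

lemma upMap_ne_zero (y : P) {B : Type u} [AddCommGroup B] [Module (IncidenceAlgebra K P)ᵐᵒᵖ B]
    (b : B) (hb : op (unit y y : IncidenceAlgebra K P) • b ≠ 0) : upMap (K := K) y b ≠ 0 := by
  intro h
  apply hb
  have h1 : upMap (K := K) y b (kdelta (upSet y) ⟨y, le_refl y⟩) = 0 := by rw [h]; rfl
  have h2 : rowElt y (kdelta (upSet y) ⟨y, le_refl y⟩) = (unit y y : IncidenceAlgebra K P) := by
    ext a c
    rw [rowElt_apply, unit_self, diag_apply]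
    simp only [kdelta, Subtype.mk.injEq]
    grind
  rw [← h2]
  exact h1

/-- Evaluation at a pair, as an additive map. -/
def evalHom (a b : P) : IncidenceAlgebra K P →+ K where
  toFun f := f a b
  map_zero' := rfl
  map_add' _ _ := rfl

lemma mul_unit (y : P) (z : (downSet y).carrier) (f : IncidenceAlgebra K P) :
    f * unit z.1 y = ∑ x : (downSet y).carrier, f x z • (unit x.1 y : IncidenceAlgebra K P) := by
  ext a b
  have h1 := map_sum (evalHom (K := K) a b)
    (fun x : (downSet y).carrier => f x z • (unit x.1 y : IncidenceAlgebra K P)) Finset.univ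
  change (∑ x : (downSet y).carrier, f x z • (unit x.1 y : IncidenceAlgebra K P)) a b =
    ∑ x : (downSet y).carrier, f x z * (unit x.1 y : IncidenceAlgebra K P) a b at h1
  have hu : ∀ (x w c : P), x ≤ y → (unit x y : IncidenceAlgebra K P) w c =
      if w = x ∧ c = y then 1 else 0 := by
    intro x w c hx
    unfold unit
    rw [elt_apply]
    grind
  have hz : z.1 ≤ y := z.2
  rw [h1, mul_univ, Finset.sum_eq_single z.1]
  · rw [hu _ _ _ hz]
    by_cases ha : a ≤ y
    · rw [Finset.sum_eq_single (⟨a, ha⟩ : (downSet y).carrier)]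
      · rw [hu _ _ _ ha]
        simp
      · intro x _ hx
        have : a ≠ x.1 := fun h => hx (Subtype.ext h.symm)
        rw [hu _ _ _ x.2]
        simp [this]
      · simp
    · rw [IncidenceAlgebra.apply_eq_zero_of_not_le (fun h => ha (le_trans h hz)), zero_mul]
      symm
      refine Finset.sum_eq_zero fun x _ => ?_
      have hx : x.1 ≤ y := x.2
      have : a ≠ x.1 := fun h => ha (h ▸ hx)
      rw [hu _ _ _ hx]
      simp [this]
  · intro x _ hx
    rw [hu _ _ _ hz]
    simp [hx]
  · simp

/-- The map to the injective module at `y` determined by a functional. -/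
noncomputable def downMap (y : P) {B : Type u} [AddCommGroup B]
    [Module (IncidenceAlgebra K P)ᵐᵒᵖ B] [Module K B]
    [IsScalarTower K (IncidenceAlgebra K P)ᵐᵒᵖ B] (φ : B →ₗ[K] K) :
    B →ₗ[(IncidenceAlgebra K P)ᵐᵒᵖ] KMod K (downSet y) where
  toFun b := fun z => φ (op (unit z.1 y : IncidenceAlgebra K P) • b)
  map_add' v w := by
    funext z
    rw [smul_add, map_add]
    rfl
  map_smul' f v := by
    obtain ⟨f, rfl⟩ := op_surjective f
    funext z
    change φ (op (unit z.1 y : IncidenceAlgebra K P) • op f • v) =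
      ∑ x : (downSet y).carrier, φ (op (unit x.1 y : IncidenceAlgebra K P) • v) * f x z
    rw [← mul_smul, ← MulOpposite.op_mul, mul_unit, Finset.op_sum, Finset.sum_smul, map_sum]
    refine Finset.sum_congr rfl fun x _ => ?_
    rw [MulOpposite.op_smul, smul_assoc, map_smul, smul_eq_mul, mul_comm]

lemma downMap_ne_zero (y : P) {B : Type u} [AddCommGroup B]
    [Module (IncidenceAlgebra K P)ᵐᵒᵖ B] [Module K B]
    [IsScalarTower K (IncidenceAlgebra K P)ᵐᵒᵖ B] (φ : B →ₗ[K] K) (b : B)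
    (hb : φ (op (unit y y : IncidenceAlgebra K P) • b) ≠ 0) : downMap y φ ≠ 0 := by
  intro h
  apply hb
  have : downMap y φ b ⟨y, le_refl y⟩ = 0 := by rw [h]; rfl
  exact this

lemma exists_downMap (y : P) {B : Type u} [AddCommGroup B]
    [Module (IncidenceAlgebra K P)ᵐᵒᵖ B] (b : B)
    (hb : op (unit y y : IncidenceAlgebra K P) • b ≠ 0) :
    ∃ g : B →ₗ[(IncidenceAlgebra K P)ᵐᵒᵖ] KMod K (downSet y), g ≠ 0 := by
  let _ : Module K B := Module.compHom B (algebraMap K (IncidenceAlgebra K P)ᵐᵒᵖ)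
  have : IsScalarTower K (IncidenceAlgebra K P)ᵐᵒᵖ B := ⟨fun c f v => by
    rw [Algebra.smul_def, mul_smul]; rfl⟩
  obtain ⟨φ, hφ⟩ : ∃ φ : B →ₗ[K] K, φ (op (unit y y : IncidenceAlgebra K P) • b) ≠ 0 := by
    by_contra! h
    exact hb ((Module.forall_dual_apply_eq_zero_iff K _).1 h)
  exact ⟨_, downMap_ne_zero y φ b hφ⟩

variable (K P) in
lemma finite_incidence : Module.Finite K (IncidenceAlgebra K P)ᵐᵒᵖ := by
  let g : IncidenceAlgebra K P →ₗ[K] (P → P → K) :=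
    { toFun := fun f => f
      map_add' := fun _ _ => rfl
      map_smul' := fun _ _ => rfl }
  have : Module.Finite K (IncidenceAlgebra K P) :=
    Module.Finite.of_injective g DFunLike.coe_injective
  exact Module.Finite.equiv (MulOpposite.opLinearEquiv K)

variable (K P) in
lemma noeth_incidence : IsNoetherianRing (IncidenceAlgebra K P)ᵐᵒᵖ := by
  have := finite_incidence K P
  exact IsNoetherianRing.of_finite K _

lemma idemMin_modKX : IdemMin (ModKX K P) := by
  intro Q
  have := noeth_incidence K P
  have hN : IsNoetherian (IncidenceAlgebra K P)ᵐᵒᵖ Q := inferInstance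
  let κ : {p : Q ⟶ Q // p ≫ p = p} → Submodule (IncidenceAlgebra K P)ᵐᵒᵖ Q :=
    fun p => LinearMap.ker p.1.hom.hom
  have hwf : WellFounded (fun p q : {p : Q ⟶ Q // p ≫ p = p} => κ p > κ q) :=
    InvImage.wf κ (wellFounded_gt (α := Submodule (IncidenceAlgebra K P)ᵐᵒᵖ Q))
  refine Subrelation.wf ?_ hwf
  rintro ⟨p, hp⟩ ⟨q, hq⟩ ⟨h1, h2, h3⟩
  have e1 : ∀ x : Q, q.hom.hom (p.hom.hom x) = p.hom.hom x := fun x =>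
    congrArg (fun r : Q ⟶ Q => r.hom.hom x) h1
  have e2 : ∀ x : Q, p.hom.hom (q.hom.hom x) = p.hom.hom x := fun x =>
    congrArg (fun r : Q ⟶ Q => r.hom.hom x) h2
  have e3 : ∀ x : Q, p.hom.hom (p.hom.hom x) = p.hom.hom x := fun x =>
    congrArg (fun r : Q ⟶ Q => r.hom.hom x) hp
  refine lt_of_le_of_ne ?_ ?_
  · intro x hx
    have hx' : q.hom.hom x = 0 := hx
    change p.hom.hom x = 0
    rw [← e2, hx', map_zero]
  · intro heq
    apply h3
    apply Subtype.ext
    apply FGModuleCat.hom_ext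
    apply LinearMap.ext
    intro x
    have hk : x - p.hom.hom x ∈ LinearMap.ker p.hom.hom := by
      change p.hom.hom (x - p.hom.hom x) = 0
      rw [map_sub, e3, sub_self]
    have hk' : x - p.hom.hom x ∈ LinearMap.ker q.hom.hom := by
      have : κ ⟨q, hq⟩ = κ ⟨p, hp⟩ := heq
      change _ ∈ κ ⟨q, hq⟩
      rw [this]; exact hk
    have hk2 : q.hom.hom (x - p.hom.hom x) = 0 := hk'
    rw [map_sub, e1, sub_eq_zero] at hk2
    exact hk2.symm

end Concrete2


section Concrete3

open MulOpposite

variable {K : Type u} [Field K] {P : Type u} [PartialOrder P] [DecidableEq P]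
  [LocallyFiniteOrder P] [Fintype P]

lemma diag_smul_ne_zero (d : P → K) {B : Type u} [AddCommGroup B]
    [Module (IncidenceAlgebra K P)ᵐᵒᵖ B] (b : B) (hb : op (diag d) • b ≠ 0) :
    ∃ y, d y ≠ 0 ∧ op (unit y y : IncidenceAlgebra K P) • b ≠ 0 := by
  by_contra! h
  apply hb
  have h1 : diag d = ∑ y, (unit y y : IncidenceAlgebra K P) * diag d := by
    ext a c
    have h2 := map_sum (evalHom (K := K) a c)
      (fun y : P => (unit y y : IncidenceAlgebra K P) * diag d) Finset.univ
    change (∑ y : P, (unit y y : IncidenceAlgebra K P) * diag d) a c =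
      ∑ y : P, ((unit y y : IncidenceAlgebra K P) * diag d) a c at h2
    rw [h2, Finset.sum_eq_single a]
    · rw [unit_self, diag_mul]
      simp
    · intro y _ hy
      rw [unit_self, diag_mul]
      simp [Ne.symm hy]
    · simp
  rw [h1, Finset.op_sum, Finset.sum_smul]
  refine Finset.sum_eq_zero fun y _ => ?_
  by_cases hd : d y = 0
  · have : (unit y y : IncidenceAlgebra K P) * diag d = 0 := by
      ext a c
      rw [unit_self, diag_mul, diag_apply]
      by_cases ha : a = y
      · subst ha; simp [hd]
      · simp [ha]
    rw [this, MulOpposite.op_zero, zero_smul]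
  · rw [MulOpposite.op_mul, mul_smul, h y hd, smul_zero]

lemma kdelta_ne_zero (S : CSet P) (x : S.carrier) : (kdelta S x : KMod K S) ≠ 0 := by
  intro h
  have h1 := congrFun h x
  change (kdelta S x : KMod K S) x = 0 at h1
  simp [kdelta] at h1

lemma unit_kdelta_ne_zero (S : CSet P) (x : S.carrier) :
    op (unit x.1 x.1 : IncidenceAlgebra K P) • (kdelta S x : KMod K S) ≠ 0 := by
  rw [kdelta_unit S x x le_rfl]
  exact kdelta_ne_zero S x

open scoped Classical in
variable (K) in
/-- The central idempotent of a connected component. -/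
noncomputable def cid (c : P) : IncidenceAlgebra K P := diag (fun a => if a ∈ compSet K c then 1 else 0)

lemma cid_comm (c : P) (f : IncidenceAlgebra K P) : cid K c * f = f * cid K c := by
  ext a b
  unfold cid
  rw [diag_mul, mul_diag]
  by_cases h : a ≤ b
  · have := compSet_iff (K := K) c h
    by_cases ha : a ∈ compSet K c
    · simp [ha, this.1 ha]
    · have hb : b ∉ compSet K c := fun hb => ha (this.2 hb)
      simp [ha, hb]
  · rw [IncidenceAlgebra.apply_eq_zero_of_not_le h]
    simp

lemma cid_idem (c : P) : cid K c * cid K c = cid K c := by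
  ext a b
  unfold cid
  rw [diag_mul, diag_apply]
  by_cases ha : a ∈ compSet K c <;> simp [ha]

/-- The action of a central idempotent. -/
noncomputable def cidMap (c : P) (B : Type u) [AddCommGroup B] [Module (IncidenceAlgebra K P)ᵐᵒᵖ B] :
    B →ₗ[(IncidenceAlgebra K P)ᵐᵒᵖ] B where
  toFun b := op (cid K c) • b
  map_add' v w := smul_add _ _ _
  map_smul' f v := by
    obtain ⟨f, rfl⟩ := op_surjective f
    rw [RingHom.id_apply, ← mul_smul, ← mul_smul, ← MulOpposite.op_mul, ← MulOpposite.op_mul,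
      cid_comm]

/-- The central idempotent as an element of the center of the category. -/
noncomputable def cidCenter (c : P) : CatCenter (ModKX.{u, u} K P) where
  app B := FGModuleCat.ofHom (cidMap (K := K) c B)
  naturality B B' f := by
    apply FGModuleCat.hom_ext
    apply LinearMap.ext
    intro b
    exact (f.hom.hom.map_smul (op (cid K c)) b).symm

lemma cidCenter_idem (c : P) : cidCenter (K := K) c * cidCenter c = cidCenter c := by
  apply CatCenter.ext
  intro B
  apply FGModuleCat.hom_ext
  apply LinearMap.ext
  intro b
  change op (cid K c) • op (cid K c) • b = op (cid K c) • b
  rw [← mul_smul, ← MulOpposite.op_mul, cid_idem]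

section Ab

variable [Abelian (ModKX.{u, u} K P)]

lemma zero_hom_hom {inst : HasZeroMorphisms (ModKX.{u, u} K P)} (M N : ModKX.{u, u} K P) : (0 : M ⟶ N).hom.hom = 0 := by
  have h : (FGModuleCat.ofHom (0 : M →ₗ[(IncidenceAlgebra K P)ᵐᵒᵖ] M) : M ⟶ M) ≫ (0 : M ⟶ N) = 0 :=
    comp_zero
  apply LinearMap.ext
  intro m
  have h2 := congrArg (fun r : M ⟶ N => r.hom.hom m) h
  have h3 : (0 : M ⟶ N).hom.hom (0 : M) = (0 : M ⟶ N).hom.hom m := h2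
  rw [← h3, map_zero]
  rfl

lemma hom_ne_zero {inst : HasZeroMorphisms (ModKX.{u, u} K P)} {M N : ModKX.{u, u} K P} (f : M ⟶ N) (h : f.hom.hom ≠ 0) : f ≠ 0 := by
  rintro rfl
  exact h (zero_hom_hom M N)

lemma exists_ne_zero {inst : HasZeroMorphisms (ModKX.{u, u} K P)} {M N : ModKX.{u, u} K P} (f : M ⟶ N) (h : f ≠ 0) : ∃ b, f.hom.hom b ≠ 0 := by
  by_contra! h1
  apply h
  apply FGModuleCat.hom_ext
  rw [zero_hom_hom]
  apply LinearMap.ext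
  exact h1

/-- `k_S` as an object of the module category. -/
noncomputable abbrev kObj (S : CSet P) : ModKX.{u, u} K P := FGModuleCat.of (IncidenceAlgebra K P)ᵐᵒᵖ (KMod K S)

lemma brick_kmod (S : CSet P) (x : S.carrier) (hc : S.Conn K) : Brick (kObj (K := K) S) := by
  constructor
  · intro h
    have h1 := (IsZero.iff_id_eq_zero _).1 h
    refine hom_ne_zero _ ?_ h1
    intro h2
    exact kdelta_ne_zero (K := K) S x (LinearMap.congr_fun h2 (kdelta S x))
  · intro p hp
    let q : KMod K S →ₗ[(IncidenceAlgebra K P)ᵐᵒᵖ] KMod K S := p.hom.hom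
    obtain ⟨h1, h2⟩ := kmod_endo S q
    have h3 := hc (fun x => q (kdelta S x) x) h2
    have hq : q (q (kdelta S x)) = q (kdelta S x) :=
      congrArg (fun r : kObj (K := K) S ⟶ kObj S => r.hom.hom (kdelta S x)) hp
    have hq2 := congrFun hq x
    rw [h1] at hq2
    have hall : ∀ v y, q v y = v y * q (kdelta S x) x := fun v y => by
      rw [h1, h3 y x]
    have hd : q (kdelta S x) x = 0 ∨ q (kdelta S x) x = 1 := by
      generalize q (kdelta S x) x = t at hq2
      by_cases ht : t = 0
      · exact Or.inl ht
      · exact Or.inr (mul_left_cancel₀ ht (by rw [hq2, mul_one]))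
    rcases hd with hd | hd
    · left
      apply FGModuleCat.hom_ext
      refine Eq.trans ?_ (zero_hom_hom (kObj (K := K) S) (kObj S)).symm
      apply LinearMap.ext
      intro v
      funext y
      refine (hall v y).trans ?_
      rw [hd, mul_zero]
      rfl
    · right
      apply FGModuleCat.hom_ext
      apply LinearMap.ext
      intro v
      funext y
      refine (hall v y).trans ?_
      rw [hd, mul_one]
      rfl

lemma linked_of (y : P) (B V : ModKX.{u, u} K P) (b : B) (v : V)
    (hb : op (unit y y : IncidenceAlgebra K P) • b ≠ 0)
    (hv : op (unit y y : IncidenceAlgebra K P) • v ≠ 0) : Linked B V := by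
  constructor
  · refine ⟨kObj (upSet y), FGModuleCat.ofHom (upMap y b), FGModuleCat.ofHom (upMap y v),
      brick_kmod (upSet y) ⟨y, le_refl y⟩ (conn_up y), hom_ne_zero _ (upMap_ne_zero y b hb),
      hom_ne_zero _ (upMap_ne_zero y v hv)⟩
  · obtain ⟨f, hf⟩ := exists_downMap y b hb
    obtain ⟨g, hg⟩ := exists_downMap y v hv
    exact ⟨kObj (downSet y), FGModuleCat.ofHom f, FGModuleCat.ofHom g,
      brick_kmod (downSet y) ⟨y, le_refl y⟩ (conn_down y), hom_ne_zero _ hf, hom_ne_zero _ hg⟩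

lemma mem_compSet_self (c : P) : c ∈ compSet K c := fun _ _ => rfl

lemma center_exists {inst : HasZeroMorphisms (ModKX.{u, u} K P)} (B : ModKX.{u, u} K P) (hB : Brick B) : ∃ c : P, (cidCenter (K := K) c).app B ≠ 0 := by
  have h1 : 𝟙 B ≠ 0 := fun h => hB.1 ((IsZero.iff_id_eq_zero _).2 h)
  obtain ⟨b, hb⟩ := exists_ne_zero _ h1
  change b ≠ 0 at hb
  have hone : (diag (fun _ => 1) : IncidenceAlgebra K P) = 1 := by
    ext a c
    rw [diag_apply, IncidenceAlgebra.one_apply]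
  have hb' : op (diag (fun _ => 1) : IncidenceAlgebra K P) • b ≠ 0 := by
    rw [hone, MulOpposite.op_one, one_smul]
    exact hb
  obtain ⟨y, -, hy⟩ := diag_smul_ne_zero _ b hb'
  refine ⟨y, hom_ne_zero _ fun h => hy ?_⟩
  have h2 : op (cid K y) • b = 0 := LinearMap.congr_fun h b
  have h3 : (cid K y) * unit y y = unit y y := by
    ext a c
    unfold cid
    rw [diag_mul, unit_self, diag_apply]
    by_cases ha : a = y
    · subst ha; simp [mem_compSet_self]
    · simp [ha]
  rw [← h3, MulOpposite.op_mul, mul_smul, h2, smul_zero]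

lemma center_linked {inst : HasZeroMorphisms (ModKX.{u, u} K P)} (B : ModKX.{u, u} K P) (c : P) (h : (cidCenter (K := K) c).app B ≠ 0) :
    Linked B (kObj (compCSet K c)) := by
  obtain ⟨b, hb⟩ := exists_ne_zero _ h
  change op (cid K c) • b ≠ 0 at hb
  obtain ⟨y, hd, hy⟩ := diag_smul_ne_zero _ b hb
  have hyc : y ∈ compSet K c := by
    by_contra h
    exact hd (if_neg h)
  exact linked_of y B _ b (kdelta (compCSet K c) ⟨y, hyc⟩) hy
    (unit_kdelta_ne_zero (compCSet K c) ⟨y, hyc⟩)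

end Ab

end Concrete3

theorem gldim_incidenceAlgebra_le_three_of_piecewiseHereditary
    [Fintype X] [HasDerivedCategory.{w} (ModKX k X)]
    (hph : IsPiecewiseHereditary.{w, w', v', u', u, u+1} (ModKX k X)) :
    gldim (ModKX k X) ≤ 3 ∧
      ∀ Q : ModKX k X, Indecomposable Q →
        projDim (ModKX k X) Q + injDim (ModKX k X) Q ≤ 4 := by
  obtain ⟨h1, h2⟩ := abstract_main hph idemMin_modKX (fun c : X => cidCenter (K := k) c)
    (fun c => cidCenter_idem c) (fun c => kObj (compCSet k c))
    (fun c => brick_kmod _ ⟨c, mem_compSet_self c⟩ (conn_comp c))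
    center_exists (fun B c _ h => center_linked B c h)
  exact ⟨h1, fun Q hQ => h2 Q (brick_of_indecomposable Q hQ)⟩

end PiecewiseHereditaryPaper
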